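/- arXiv:2603.21733 — 4 statements merged into one kernel-verified Lean document; each statement's English description precedes it below -/
import Mathlib

section
/- Let τ: ℕ → (0,∞) be a sequence such that both τ and its dual sequence τ* are nondecreasing. Then τ has the lower regularity property (LRP) if and only if τ admits a Dini regularization σ. Moreover, in that case σ can be chosen so that both σ and its dual sequence σ* are nondecreasing. -/
open scoped BigOperators ENNReal NNReal
open MeasureTheory

noncomputable section

namespace GreedyRenorm

/-! ### Sequence notions.  Sequences are indexed by `ℕ`, understood as defined on the
positive integers, with the convention that the value at `0` is `0` where relevant. -/

/-- `σ` is nondecreasing (on the positive integers). -/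
def MonoFrom1 (σ : ℕ → ℝ) : Prop := ∀ m : ℕ, 1 ≤ m → σ m ≤ σ (m + 1)

/-- The dual sequence `σ*(m) = m / σ(m)` is nondecreasing (on the positive integers). -/
def DualMonoFrom1 (σ : ℕ → ℝ) : Prop :=
  ∀ m : ℕ, 1 ≤ m → (m : ℝ) / σ m ≤ ((m : ℝ) + 1) / σ (m + 1)

/-- Lower regularity property: `σ (r m) ≥ 2 σ m` for some positive integer `r`. -/
def HasLRP (σ : ℕ → ℝ) : Prop :=
  ∃ r : ℕ, 1 ≤ r ∧ ∀ m : ℕ, 1 ≤ m → 2 * σ m ≤ σ (r * m)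

/-- Upper regularity property: `σ (r m) ≤ (r/2) σ m` for some positive integer `r`. -/
def HasURP (σ : ℕ → ℝ) : Prop :=
  ∃ r : ℕ, 1 ≤ r ∧ ∀ m : ℕ, 1 ≤ m → σ (r * m) ≤ ((r : ℝ) / 2) * σ m

/-- Dini regularity: the discrete derivative of `σ` is equivalent to `σ(m)/m`. -/
def DiniRegular (σ : ℕ → ℝ) : Prop :=
  ∃ C : ℝ, 1 ≤ C ∧ ∀ m : ℕ, 1 ≤ m →
    (1 / C) * (σ m / (m : ℝ)) ≤ σ m - σ (m - 1) ∧
      σ m - σ (m - 1) ≤ C * (σ m / (m : ℝ))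

/-- `σ` and `τ` are equivalent sequences (on the positive integers). -/
def EquivSeq (σ τ : ℕ → ℝ) : Prop :=
  ∃ D : ℝ, 1 ≤ D ∧ ∀ m : ℕ, 1 ≤ m → (1 / D) * τ m ≤ σ m ∧ σ m ≤ D * τ m

/-- `σ` is a Dini regularization of `τ`: it is Dini-regular and equivalent to `τ`
(with the convention `σ 0 = 0`). -/
def DiniRegularization (σ τ : ℕ → ℝ) : Prop :=
  σ 0 = 0 ∧ DiniRegular σ ∧ EquivSeq σ τ

/-- A Dini regularization of `τ` which is positive and such that both it and its dual
sequence are nondecreasing. -/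
def GoodDiniReg (σ τ : ℕ → ℝ) : Prop :=
  DiniRegularization σ τ ∧ (∀ m : ℕ, 1 ≤ m → 0 < σ m) ∧ MonoFrom1 σ ∧ DualMonoFrom1 σ

/-! ### Fundamental functions and norms -/

/-- The fundamental function of a family `y` computed with respect to a gauge `ν`:
`m ↦ sup { ν (∑_{n ∈ A} ε n • y n) : |A| ≤ m, |ε n| = 1 }`. -/
def fundFunWith (𝕜 : Type*) [RCLike 𝕜] {N Y : Type*} [AddCommGroup Y] [Module 𝕜 Y]
    (ν : Y → ℝ) (y : N → Y) (m : ℕ) : ℝ :=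
  sSup {r : ℝ | ∃ (A : Finset N) (ε : N → 𝕜), A.card ≤ m ∧ (∀ n, ‖ε n‖ = 1) ∧
    r = ν (∑ n ∈ A, ε n • y n)}

/-- The fundamental function of a family `y` in a normed space. -/
def fundFun (𝕜 : Type*) [RCLike 𝕜] {N Y : Type*} [SeminormedAddCommGroup Y]
    [NormedSpace 𝕜 Y] (y : N → Y) (m : ℕ) : ℝ :=
  fundFunWith 𝕜 (fun v => ‖v‖) y m

/-- `ν` is an equivalent norm on the normed space `X`. -/
structure IsEquivNorm (𝕜 : Type*) [RCLike 𝕜] {X : Type*} [NormedAddCommGroup X]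
    [NormedSpace 𝕜 X] (ν : X → ℝ) : Prop where
  add_le : ∀ f g : X, ν (f + g) ≤ ν f + ν g
  smul_eq : ∀ (a : 𝕜) (f : X), ν (a • f) = ‖a‖ * ν f
  lower : ∃ c : ℝ, 0 < c ∧ ∀ f : X, c * ‖f‖ ≤ ν f
  upper : ∃ C : ℝ, 0 < C ∧ ∀ f : X, ν f ≤ C * ‖f‖

section Basis

variable {𝕜 : Type*} [RCLike 𝕜] {N : Type*} {X : Type*}
  [NormedAddCommGroup X] [NormedSpace 𝕜 X]

/-- The dual norm, relative to the gauge `ν` on `X`, of a functional `g`. -/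
def dualNormWith (ν : X → ℝ) (g : X →L[𝕜] 𝕜) : ℝ :=
  sSup {r : ℝ | ∃ f : X, ν f ≤ 1 ∧ r = ‖g f‖}

/-- The fundamental function of the dual system `xs`, computed with the dual norm of `ν`. -/
def dualFundFunWith (ν : X → ℝ) (xs : N → X →L[𝕜] 𝕜) (m : ℕ) : ℝ :=
  sSup {r : ℝ | ∃ (B : Finset N) (δ : N → 𝕜), B.card ≤ m ∧ (∀ n, ‖δ n‖ = 1) ∧
    r = dualNormWith ν (∑ n ∈ B, δ n • xs n)}

/-- `A` is a greedy set of `f` with respect to the coordinate functionals `xs`. -/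
def GreedySet (xs : N → X →L[𝕜] 𝕜) (f : X) (A : Finset N) : Prop :=
  ∀ n ∈ A, ∀ k, k ∉ A → ‖xs k f‖ ≤ ‖xs n f‖

/-- `S_A(f) = ∑_{n ∈ A} x_n^*(f) • x_n`. -/
def greedyProj (x : N → X) (xs : N → X →L[𝕜] 𝕜) (A : Finset N) (f : X) : X :=
  ∑ n ∈ A, xs n f • x n

/-- A complete minimal system with its (biorthogonal) dual system. -/
structure IsCompleteMinimal (x : N → X) (xs : N → X →L[𝕜] 𝕜) : Prop where
  dense_span : (Submodule.span 𝕜 (Set.range x)).topologicalClosure = ⊤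
  biorth_diag : ∀ n, xs n (x n) = 1
  biorth_off : ∀ n k, n ≠ k → xs n (x k) = 0

/-- A basis: a complete minimal system which is semi-normalized and `M`-bounded. -/
structure IsBasis (x : N → X) (xs : N → X →L[𝕜] 𝕜) : Prop where
  dense_span : (Submodule.span 𝕜 (Set.range x)).topologicalClosure = ⊤
  biorth_diag : ∀ n, xs n (x n) = 1
  biorth_off : ∀ n k, n ≠ k → xs n (x k) = 0
  norm_pos : ∃ c : ℝ, 0 < c ∧ ∀ n, c ≤ ‖x n‖
  norm_bdd : ∃ C : ℝ, ∀ n, ‖x n‖ ≤ C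
  mBounded : ∃ C : ℝ, ∀ n, ‖x n‖ * ‖xs n‖ ≤ C

/-- The basis is `C`-greedy with respect to the gauge `ν`. -/
def GreedyWith (ν : X → ℝ) (x : N → X) (xs : N → X →L[𝕜] 𝕜) (C : ℝ) : Prop :=
  ∀ (f : X) (A B : Finset N) (a : N → 𝕜), GreedySet xs f A → B.card ≤ A.card →
    ν (f - greedyProj x xs A f) ≤ C * ν (f - ∑ n ∈ B, a n • x n)

/-- The basis is `C`-almost greedy with respect to the gauge `ν`. -/
def AlmostGreedyWith (ν : X → ℝ) (x : N → X) (xs : N → X →L[𝕜] 𝕜) (C : ℝ) : Prop :=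
  ∀ (f : X) (A B : Finset N), GreedySet xs f A → B.card ≤ A.card →
    ν (f - greedyProj x xs A f) ≤ C * ν (f - greedyProj x xs B f)

/-- The basis is `C`-quasi-greedy with respect to the gauge `ν`. -/
def QuasiGreedyWith (ν : X → ℝ) (x : N → X) (xs : N → X →L[𝕜] 𝕜) (C : ℝ) : Prop :=
  ∀ (f : X) (A : Finset N), GreedySet xs f A → ν (greedyProj x xs A f) ≤ C * ν f

/-- The basis is lattice `C`-unconditional with respect to the gauge `ν`. -/
def LatticeUnconditionalWith (ν : X → ℝ) (x : N → X) (xs : N → X →L[𝕜] 𝕜) (C : ℝ) : Prop :=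
  ∀ (f : X) (A : Finset N) (lam : N → 𝕜) (M : ℝ), (∀ n, ‖lam n‖ ≤ M) →
    ν (∑ n ∈ A, lam n • xs n f • x n) ≤ C * M * ν f

/-- The basis is suppression `C`-unconditional (with respect to the ambient norm). -/
def SuppressionUnconditional (x : N → X) (xs : N → X →L[𝕜] 𝕜) (C : ℝ) : Prop :=
  ∀ (f : X) (A : Finset N), ‖greedyProj x xs A f‖ ≤ C * ‖f‖

/-- The family `x` is `C`-democratic (with respect to the ambient norm). -/
def Democratic (x : N → X) (C : ℝ) : Prop :=
  ∀ A B : Finset N, A.card ≤ B.card → ‖∑ n ∈ A, x n‖ ≤ C * ‖∑ n ∈ B, x n‖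

/-- The basis is `C`-bidemocratic (with respect to the ambient norm; the dual system
carries the operator norm). -/
def Bidemocratic (x : N → X) (xs : N → X →L[𝕜] 𝕜) (C : ℝ) : Prop :=
  ∀ (A B : Finset N) (ε δ : N → 𝕜), (∀ n, ‖ε n‖ = 1) → (∀ n, ‖δ n‖ = 1) →
    ‖∑ n ∈ A, ε n • x n‖ * ‖∑ n ∈ B, δ n • xs n‖ ≤ C * (max A.card B.card : ℕ)

/-- The basis is `C`-bidemocratic with respect to the gauge `ν` (the dual system carries
the corresponding dual norm). -/
def BidemocraticWith (ν : X → ℝ) (x : N → X) (xs : N → X →L[𝕜] 𝕜) (C : ℝ) : Prop :=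
  ∀ (A B : Finset N) (ε δ : N → 𝕜), (∀ n, ‖ε n‖ = 1) → (∀ n, ‖δ n‖ = 1) →
    ν (∑ n ∈ A, ε n • x n) * dualNormWith ν (∑ n ∈ B, δ n • xs n) ≤
      C * (max A.card B.card : ℕ)

/-- Property (A) with respect to the gauge `ν`. -/
def PropertyAWith (ν : X → ℝ) (x : N → X) (xs : N → X →L[𝕜] 𝕜) : Prop :=
  ∀ (A B : Finset N) (ε δ : N → 𝕜) (g : X),
    A.card ≤ B.card → Disjoint A B → (∀ n, ‖ε n‖ = 1) → (∀ n, ‖δ n‖ = 1) →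
    (∀ n, (n ∈ A ∨ n ∈ B) → xs n g = 0) → (∀ n, ‖xs n g‖ ≤ 1) →
    ν ((∑ n ∈ A, ε n • x n) + g) ≤ ν ((∑ n ∈ B, δ n • x n) + g)

end Basis

/-- The basis `x` (indexed by `ℕ`) is `C`-subsymmetric with respect to the gauge `ν`:
every "dilated sign change" extends to an isomorphism onto its range with distortion
constants at most `C`. -/
def SubsymWith (𝕜 : Type*) [RCLike 𝕜] {X : Type*} [NormedAddCommGroup X]
    [NormedSpace 𝕜 X] (ν : X → ℝ) (x : ℕ → X) (C : ℝ) : Prop :=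
  ∀ (lam : ℕ → 𝕜), (∀ n, ‖lam n‖ = 1) → ∀ β : ℕ → ℕ, StrictMono β →
    ∃ T : X →L[𝕜] X, (∀ n, T (x n) = lam n • x (β n)) ∧
      (∀ f : X, ν (T f) ≤ C * ν f) ∧ (∀ f : X, ν f ≤ C * ν (T f))

/-- `X` has nontrivial Rademacher cotype. -/
def NontrivialCotype (X : Type*) [SeminormedAddCommGroup X] : Prop :=
  ∃ q C : ℝ, 0 < q ∧ 0 < C ∧ ∀ (n : ℕ) (f : Fin n → X),
    (∑ i, ‖f i‖ ^ q) ^ (1 / q) ≤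
      C * (((2 : ℝ) ^ n)⁻¹ * ∑ ε : Fin n → Bool, ‖∑ i, (if ε i then f i else -f i)‖)

/-- `X` has nontrivial Rademacher type. -/
def NontrivialType (X : Type*) [SeminormedAddCommGroup X] : Prop :=
  ∃ p C : ℝ, 1 < p ∧ 0 < C ∧ ∀ (n : ℕ) (f : Fin n → X),
    ((2 : ℝ) ^ n)⁻¹ * ∑ ε : Fin n → Bool, ‖∑ i, (if ε i then f i else -f i)‖ ≤
      C * (∑ i, ‖f i‖ ^ p) ^ (1 / p)

end GreedyRenorm
namespace GreedyRenorm

/-- A sequence that is nondecreasing on the positive integers is monotone there. -/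
lemma MonoFrom1.le_of_le {σ : ℕ → ℝ} (h : MonoFrom1 σ) {m n : ℕ} (hm : 1 ≤ m) (hmn : m ≤ n) :
    σ m ≤ σ n := by
  induction n, hmn using Nat.le_induction with
  | base => exact le_rfl
  | succ n hn ih => exact ih.trans (h n (hm.trans hn))

/-- The Cesàro-type regularization `m ↦ ∑_{k = 1}^m τ(k) / k`. -/
def diniSum (τ : ℕ → ℝ) (m : ℕ) : ℝ :=
  ∑ k ∈ Finset.range m, τ (k + 1) / ((k : ℝ) + 1)

lemma diniSum_zero (τ : ℕ → ℝ) : diniSum τ 0 = 0 := by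
  simp [diniSum]

lemma diniSum_succ (τ : ℕ → ℝ) (m : ℕ) :
    diniSum τ (m + 1) = diniSum τ m + τ (m + 1) / ((m : ℝ) + 1) := by
  simp [diniSum, Finset.sum_range_succ]

lemma DualMonoFrom1.div_succ_le {τ : ℕ → ℝ} (h : DualMonoFrom1 τ)
    (hpos : ∀ m : ℕ, 1 ≤ m → 0 < τ m) {m : ℕ} (hm : 1 ≤ m) :
    τ (m + 1) / ((m : ℝ) + 1) ≤ τ m / m := by
  have hm' : (0 : ℝ) < m := by exact_mod_cast hm
  have h₁ := h m hm
  rw [div_le_div_iff₀ (hpos m hm) (hpos _ (by omega))] at h₁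
  rw [div_le_div_iff₀ (by positivity) hm']
  linarith

lemma le_diniSum {τ : ℕ → ℝ} (hpos : ∀ m : ℕ, 1 ≤ m → 0 < τ m) (h : DualMonoFrom1 τ) {m : ℕ}
    (hm : 1 ≤ m) : τ m ≤ diniSum τ m := by
  induction m, hm using Nat.le_induction with
  | base => simp [diniSum]
  | succ m hm ih =>
    have hm' : (0 : ℝ) < m := by exact_mod_cast hm
    have h₁ := h.div_succ_le hpos hm
    rw [le_div_iff₀ hm'] at h₁
    have h₂ : τ (m + 1) / ((m : ℝ) + 1) * (m + 1) = τ (m + 1) := by field_simp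
    rw [diniSum_succ]
    linarith

lemma diniSum_pos {τ : ℕ → ℝ} (hpos : ∀ m : ℕ, 1 ≤ m → 0 < τ m) (h : DualMonoFrom1 τ) {m : ℕ}
    (hm : 1 ≤ m) : 0 < diniSum τ m :=
  (hpos m hm).trans_le (le_diniSum hpos h hm)

lemma monoFrom1_diniSum {τ : ℕ → ℝ} (hpos : ∀ m : ℕ, 1 ≤ m → 0 < τ m) :
    MonoFrom1 (diniSum τ) := fun m _ => by
  have h₁ := hpos (m + 1) (by omega)
  have h₂ : 0 ≤ τ (m + 1) / ((m : ℝ) + 1) := by positivity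
  rw [diniSum_succ]
  linarith

lemma dualMonoFrom1_diniSum {τ : ℕ → ℝ} (hpos : ∀ m : ℕ, 1 ≤ m → 0 < τ m)
    (h : DualMonoFrom1 τ) : DualMonoFrom1 (diniSum τ) := fun m hm => by
  have hm' : (0 : ℝ) < m := by exact_mod_cast hm
  have h₁ := h.div_succ_le hpos hm
  rw [le_div_iff₀ hm'] at h₁
  have h₂ := le_diniSum hpos h hm
  rw [div_le_div_iff₀ (diniSum_pos hpos h hm) (diniSum_pos hpos h (by omega)), diniSum_succ]
  linarith

lemma diniSum_add_le {τ : ℕ → ℝ} (hpos : ∀ m : ℕ, 1 ≤ m → 0 < τ m) (hmono : MonoFrom1 τ)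
    (n i : ℕ) : diniSum τ (n + i) ≤ diniSum τ n + i * (τ (n + i) / ((n : ℝ) + 1)) := by
  induction i with
  | zero => simp
  | succ i ih =>
    have h₁ : τ (n + i) * (i : ℝ) ≤ τ (n + i + 1) * i := by
      rcases Nat.eq_zero_or_pos i with rfl | hi
      · simp
      · exact mul_le_mul_of_nonneg_right (hmono _ (by omega)) (by positivity)
    have h₂ : (i : ℝ) * (τ (n + i) / ((n : ℝ) + 1)) ≤ i * (τ (n + i + 1) / ((n : ℝ) + 1)) := by
      rw [← mul_div_assoc, ← mul_div_assoc]
      gcongr ?_ / _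
      linarith
    have h₃ := hpos (n + i + 1) (by omega)
    have h₄ : τ (n + i + 1) / (((n + i : ℕ) : ℝ) + 1) ≤ τ (n + i + 1) / ((n : ℝ) + 1) := by
      gcongr
      omega
    rw [← add_assoc, diniSum_succ]
    push_cast at h₄ ⊢
    linarith

lemma diniSum_le_of_lrp {τ : ℕ → ℝ} (hpos : ∀ m : ℕ, 1 ≤ m → 0 < τ m) (hmono : MonoFrom1 τ)
    {r : ℕ} (hr : 2 ≤ r) (hlrp : ∀ m : ℕ, 1 ≤ m → 2 * τ m ≤ τ (r * m)) {m : ℕ} (hm : 1 ≤ m) :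
    diniSum τ m ≤ 2 * r * τ m := by
  induction m using Nat.strong_induction_on with
  | _ m ih =>
    set n := m / r with hn
    have hnm : n < m := Nat.div_lt_self hm hr
    have hrn : r * n ≤ m := Nat.mul_div_le m r
    have hlt : m < r * (n + 1) := Nat.lt_mul_div_succ m (by omega)
    have hτ := hpos m hm
    have h₁ : diniSum τ n ≤ r * τ m := by
      rcases Nat.eq_zero_or_pos n with h0 | h0
      · rw [h0, diniSum_zero]
        positivity
      · have h₂ := ih n hnm h0
        have h₃ := (hlrp n h0).trans
          (hmono.le_of_le (Nat.mul_pos (by omega) h0) hrn)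
        have h₄ : (r : ℝ) * (2 * τ n) ≤ r * τ m := by gcongr
        linarith
    have h₂ := diniSum_add_le hpos hmono n (m - n)
    rw [Nat.add_sub_cancel' hnm.le] at h₂
    have h₃ : ((m - n : ℕ) : ℝ) * (τ m / ((n : ℝ) + 1)) ≤ r * τ m := by
      rw [← mul_div_assoc, div_le_iff₀ (by positivity)]
      have h₄ : ((m - n : ℕ) : ℝ) ≤ r * ((n : ℝ) + 1) := by
        exact_mod_cast (Nat.sub_le m n).trans hlt.le
      nlinarith
    linarith

lemma diniRegularization_diniSum {τ : ℕ → ℝ} (hpos : ∀ m : ℕ, 1 ≤ m → 0 < τ m)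
    (hmono : MonoFrom1 τ) (hdmono : DualMonoFrom1 τ) (hlrp : HasLRP τ) :
    DiniRegularization (diniSum τ) τ := by
  obtain ⟨r, hr, hlrp⟩ := hlrp
  have hr2 : 2 ≤ r := by
    by_contra! hlt
    obtain rfl : r = 1 := by omega
    have h₁ := hlrp 1 le_rfl
    have h₂ := hpos 1 le_rfl
    norm_num at h₁
    linarith
  have hD : (1 : ℝ) ≤ 2 * r := by
    have : (2 : ℝ) ≤ r := by exact_mod_cast hr2
    linarith
  have hD0 : (0 : ℝ) < 2 * r := by linarith
  refine ⟨diniSum_zero τ, ⟨2 * r, hD, fun m hm => ?_⟩, ⟨2 * r, hD, fun m hm => ⟨?_, ?_⟩⟩⟩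
  · have hm' : (0 : ℝ) < m := by exact_mod_cast hm
    have hdiff : diniSum τ m - diniSum τ (m - 1) = τ m / m := by
      obtain ⟨k, rfl⟩ : ∃ k, m = k + 1 := ⟨m - 1, by omega⟩
      simp [diniSum_succ]
    rw [hdiff, ← mul_div_assoc, ← mul_div_assoc]
    refine ⟨?_, ?_⟩
    · gcongr
      rw [one_div_mul_eq_div, div_le_iff₀' hD0]
      exact diniSum_le_of_lrp hpos hmono hr2 hlrp hm
    · gcongr
      have h₁ := le_diniSum hpos hdmono hm
      nlinarith [hpos m hm]
  · rw [one_div_mul_eq_div, div_le_iff₀' hD0]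
    have h₁ := le_diniSum hpos hdmono hm
    nlinarith [hpos m hm]
  · exact diniSum_le_of_lrp hpos hmono hr2 hlrp hm

/-- A positive Dini-regular sequence grows by a fixed factor along dyadic dilations. -/
lemma DiniRegular.exists_mul_le_two_mul {σ : ℕ → ℝ} (hpos : ∀ m : ℕ, 1 ≤ m → 0 < σ m)
    (h : DiniRegular σ) :
    ∃ q : ℝ, 1 < q ∧ ∀ m : ℕ, 1 ≤ m → q * σ m ≤ σ (2 * m) := by
  obtain ⟨C, hC, h⟩ := h
  have hC0 : 0 < C := by linarith
  have hstep (m : ℕ) (hm : 1 ≤ m) :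
      σ m + 1 / C * (σ (m + 1) / ((m : ℝ) + 1)) ≤ σ (m + 1) := by
    have h₁ := (h (m + 1) (by omega)).1
    simp only [Nat.add_sub_cancel, Nat.cast_add, Nat.cast_one] at h₁
    linarith
  have hmono : MonoFrom1 σ := fun m hm => by
    have h₁ := hpos (m + 1) (by omega)
    have h₂ : 0 ≤ 1 / C * (σ (m + 1) / ((m : ℝ) + 1)) := by positivity
    linarith [hstep m hm]
  refine ⟨1 + 1 / (2 * C), by simp [hC0], fun m hm => ?_⟩
  have hm' : (0 : ℝ) < m := by exact_mod_cast hm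
  have key (i : ℕ) (hi : i ≤ m) : σ m + i * (1 / C * (σ m / (2 * m))) ≤ σ (m + i) := by
    induction i with
    | zero => simp
    | succ i ih =>
      have h₁ := hstep (m + i) (by omega)
      have h₂ := ih (by omega)
      have hσ := hpos m hm
      have h₃ : 1 / C * (σ m / (2 * m)) ≤
          1 / C * (σ (m + i + 1) / (((m + i : ℕ) : ℝ) + 1)) := by
        gcongr
        · exact (hpos _ (by omega)).le
        · exact hmono.le_of_le hm (by omega)
        · exact_mod_cast (by omega : m + i + 1 ≤ 2 * m)
      rw [← add_assoc]
      push_cast at h₁ h₃ ⊢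
      linarith
  have h₁ := key m le_rfl
  have h₂ : (m : ℝ) * (1 / C * (σ m / (2 * m))) = 1 / (2 * C) * σ m := by field_simp
  rw [← two_mul, h₂] at h₁
  linarith

lemma DiniRegularization.hasLRP {σ τ : ℕ → ℝ} (hpos : ∀ m : ℕ, 1 ≤ m → 0 < σ m)
    (h : DiniRegularization σ τ) : HasLRP τ := by
  obtain ⟨-, hdini, D, hD, hequiv⟩ := h
  obtain ⟨q, hq, hgrow⟩ := hdini.exists_mul_le_two_mul hpos
  have hD0 : 0 < D := by linarith
  have hpow (j m : ℕ) (hm : 1 ≤ m) : q ^ j * σ m ≤ σ (2 ^ j * m) := by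
    induction j with
    | zero => simp
    | succ j ih =>
      have h₁ := hgrow (2 ^ j * m) (Nat.mul_pos (by positivity) hm)
      rw [← mul_assoc, ← pow_succ'] at h₁
      refine le_trans ?_ h₁
      rw [pow_succ', mul_assoc]
      gcongr
  obtain ⟨j, hj⟩ := pow_unbounded_of_one_lt (2 * D * D) hq
  refine ⟨2 ^ j, Nat.one_le_two_pow, fun m hm => ?_⟩
  have h₁ := (hequiv m hm).1
  have h₂ := (hequiv (2 ^ j * m) (Nat.mul_pos (by positivity) hm)).2
  have h₃ : 2 * D * D * σ m ≤ D * τ (2 ^ j * m) :=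
    (mul_le_mul_of_nonneg_right hj.le (hpos m hm).le).trans ((hpow j m hm).trans h₂)
  rw [one_div_mul_eq_div, div_le_iff₀' hD0] at h₁
  have h₄ : 2 * D * σ m ≤ τ (2 ^ j * m) := by
    refine le_of_mul_le_mul_left ?_ hD0
    linarith
  linarith

/-- Lemma 3.2: for a sequence `τ` with `τ` and `τ*` nondecreasing,
`τ` has the LRP iff it admits a Dini regularization; moreover the Dini regularization
can be chosen with `σ` and `σ*` nondecreasing. -/
theorem lrp_iff_exists_diniRegularization (τ : ℕ → ℝ)
    (hpos : ∀ m : ℕ, 1 ≤ m → 0 < τ m) (hmono : MonoFrom1 τ) (hdmono : DualMonoFrom1 τ) :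
    (HasLRP τ ↔ ∃ σ : ℕ → ℝ, (∀ m : ℕ, 1 ≤ m → 0 < σ m) ∧ DiniRegularization σ τ) ∧
    (HasLRP τ → ∃ σ : ℕ → ℝ, (∀ m : ℕ, 1 ≤ m → 0 < σ m) ∧ DiniRegularization σ τ ∧
      MonoFrom1 σ ∧ DualMonoFrom1 σ) :=
  ⟨⟨fun h => ⟨diniSum τ, fun _ => diniSum_pos hpos hdmono,
      diniRegularization_diniSum hpos hmono hdmono h⟩,
    fun ⟨_, hσ, h⟩ => h.hasLRP hσ⟩,
   fun h => ⟨diniSum τ, fun _ => diniSum_pos hpos hdmono,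
      diniRegularization_diniSum hpos hmono hdmono h, monoFrom1_diniSum hpos,
      dualMonoFrom1_diniSum hpos hdmono⟩⟩

end GreedyRenorm
end
end

section
/- Let f: ℕ → (0,∞) be a nondecreasing unbounded sequence. Then there exist a nondecreasing unbounded sequence g: ℕ → (0,∞) and a constant D ≥ 1 such that g(m) ≤ f(m) for all m ∈ ℕ and g(2m) ≤ D·g(m) for all m ∈ ℕ. -/
open scoped BigOperators ENNReal NNReal
open MeasureTheory

noncomputable section

namespace GreedyRenorm

/-- A minorant of `F` on the dyadic scale: it starts at `F 0` and at most doubles at each step. -/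
def dyadicMinorant (F : ℕ → ℝ) : ℕ → ℝ
  | 0 => F 0
  | k + 1 => min (2 * dyadicMinorant F k) (F (k + 1))

lemma dyadicMinorant_le (F : ℕ → ℝ) (k : ℕ) : dyadicMinorant F k ≤ F k := by
  cases k with
  | zero => exact le_rfl
  | succ k => exact min_le_right _ _

lemma dyadicMinorant_succ_le (F : ℕ → ℝ) (k : ℕ) :
    dyadicMinorant F (k + 1) ≤ 2 * dyadicMinorant F k :=
  min_le_left _ _

lemma dyadicMinorant_pos {F : ℕ → ℝ} (hF : ∀ k, 0 < F k) (k : ℕ) : 0 < dyadicMinorant F k := by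
  induction k with
  | zero => exact hF 0
  | succ k ih => exact lt_min (by positivity) (hF _)

lemma monotone_dyadicMinorant {F : ℕ → ℝ} (hF : ∀ k, 0 < F k) (hmono : Monotone F) :
    Monotone (dyadicMinorant F) := by
  refine monotone_nat_of_le_succ fun k => le_min ?_ ?_
  · linarith [dyadicMinorant_pos hF k]
  · exact (dyadicMinorant_le F k).trans (hmono k.le_succ)

lemma exists_lt_dyadicMinorant {F : ℕ → ℝ} (hF : ∀ k, 0 < F k) (hmono : Monotone F)
    (hunb : ∀ M : ℝ, ∃ k, M < F k) (M : ℝ) : ∃ k, M < dyadicMinorant F k := by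
  by_contra! hbdd
  obtain ⟨K, hK⟩ := hunb M
  have hgrow : ∀ n, 2 ^ n * dyadicMinorant F K ≤ dyadicMinorant F (K + n) := by
    intro n
    induction n with
    | zero => simp
    | succ n ih =>
      have hstep : dyadicMinorant F (K + n + 1) = 2 * dyadicMinorant F (K + n) := by
        refine (min_choice (2 * dyadicMinorant F (K + n)) (F (K + n + 1))).resolve_right
          fun h => ?_
        have hle : F (K + n + 1) ≤ M := h ▸ hbdd (K + n + 1)
        linarith [hmono (show K ≤ K + n + 1 by lia)]
      rw [← add_assoc, hstep, pow_succ]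
      linarith
  obtain ⟨n, hn⟩ := pow_unbounded_of_one_lt (M / dyadicMinorant F K) one_lt_two
  rw [div_lt_iff₀ (dyadicMinorant_pos hF K)] at hn
  linarith [hgrow n, hbdd (K + n)]

/-- Lemma 6.1: any nondecreasing unbounded positive sequence dominates a
nondecreasing unbounded positive sequence which is doubling. -/
theorem exists_doubling_minorant (f : ℕ → ℝ)
    (hpos : ∀ m : ℕ, 1 ≤ m → 0 < f m) (hmono : MonoFrom1 f)
    (hunb : ∀ M : ℝ, ∃ m : ℕ, 1 ≤ m ∧ M < f m) :
    ∃ (g : ℕ → ℝ) (D : ℝ), 1 ≤ D ∧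
      (∀ m : ℕ, 1 ≤ m → 0 < g m) ∧ MonoFrom1 g ∧
      (∀ M : ℝ, ∃ m : ℕ, 1 ≤ m ∧ M < g m) ∧
      (∀ m : ℕ, 1 ≤ m → g m ≤ f m) ∧
      (∀ m : ℕ, 1 ≤ m → g (2 * m) ≤ D * g m) := by
  have hmon : ∀ m n : ℕ, 1 ≤ m → m ≤ n → f m ≤ f n := fun m n hm hmn =>
    Nat.le_induction le_rfl (fun k hk ih => ih.trans (hmono k (hm.trans hk))) n hmn
  have hF : ∀ k : ℕ, 0 < f (2 ^ k) := fun k => hpos _ Nat.one_le_two_pow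
  have hFmono : Monotone fun k : ℕ => f (2 ^ k) := fun i j hij =>
    hmon _ _ Nat.one_le_two_pow (Nat.pow_le_pow_right two_pos hij)
  have hFunb : ∀ M : ℝ, ∃ k : ℕ, M < f (2 ^ k) := fun M =>
    let ⟨m, hm, hM⟩ := hunb M
    ⟨m, hM.trans_le (hmon _ _ hm Nat.lt_two_pow_self.le)⟩
  refine ⟨fun m => dyadicMinorant (fun k => f (2 ^ k)) (Nat.log 2 m), 2, one_le_two,
    fun m _ => dyadicMinorant_pos hF _,
    fun m _ => monotone_dyadicMinorant hF hFmono (Nat.log_mono_right m.le_succ),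
    fun M => ?_, fun m hm => ?_, fun m hm => ?_⟩
  · obtain ⟨k, hk⟩ := exists_lt_dyadicMinorant hF hFmono hFunb M
    exact ⟨2 ^ k, Nat.one_le_two_pow, by simpa [Nat.log_pow one_lt_two] using hk⟩
  · exact (dyadicMinorant_le _ _).trans
      (hmon _ _ Nat.one_le_two_pow (Nat.pow_log_le_self 2 (by lia)))
  · have hlog : Nat.log 2 (2 * m) = Nat.log 2 m + 1 := by
      rw [mul_comm, Nat.log_mul_base one_lt_two (by lia)]
    simpa only [hlog] using dyadicMinorant_succ_le (fun k => f (2 ^ k)) (Nat.log 2 m)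

end GreedyRenorm
end
end

section
/- Let X = (x_n)_{n∈N} be a C-greedy basis of a real or complex Banach space X, C ≥ 1. Then X admits an equivalent norm with respect to which X is lattice 1-unconditional and C-greedy; moreover, the equivalent norm can be chosen so that the fundamental function ψ of X relative to it satisfies ψ = φ_u[X], and the fundamental function ψ* of the dual system relative to the dual of the new norm satisfies ψ* ≤ φ_u[X*]. -/
open scoped BigOperators ENNReal NNReal
open MeasureTheory

noncomputable section

namespace GreedyRenorm

section Renorming

open scoped Classical

variable {𝕜 : Type*} [RCLike 𝕜] {N : Type*} {X : Type*}

/-- Every scalar in the closed unit disc is a convex combination of two unimodular scalars. -/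
theorem exists_convexComb_unimodular {z : 𝕜} (hz : ‖z‖ ≤ 1) :
    ∃ (u w : 𝕜) (s t : ℝ), ‖u‖ = 1 ∧ ‖w‖ = 1 ∧ 0 ≤ s ∧ 0 ≤ t ∧ s + t = 1 ∧
      z = (s : 𝕜) * u + (t : 𝕜) * w := by
  obtain ⟨u, hu, hzu⟩ : ∃ u : 𝕜, ‖u‖ = 1 ∧ z = (‖z‖ : 𝕜) * u := by
    by_cases h : z = 0
    · exact ⟨1, by simp, by simp [h]⟩
    · have h' : (‖z‖ : 𝕜) ≠ 0 := by simpa using h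
      exact ⟨z / ‖z‖, by simp [h], by field_simp⟩
  refine ⟨u, -u, (1 + ‖z‖) / 2, (1 - ‖z‖) / 2, hu, by simpa using hu,
    by positivity, by linarith, by ring, ?_⟩
  push_cast
  nth_rewrite 1 [hzu]
  ring

section Convexity

variable [AddCommGroup X] [Module 𝕜 X]

/-- A seminorm is bounded on a segment by any bound for its values at the endpoints. -/
theorem seminorm_convexComb_le (p : Seminorm 𝕜 X) {y z : X} {s t K : ℝ} (hs : 0 ≤ s)
    (ht : 0 ≤ t) (hst : s + t = 1) (hy : p y ≤ K) (hz : p z ≤ K) :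
    p ((s : 𝕜) • y + (t : 𝕜) • z) ≤ K := by
  calc p ((s : 𝕜) • y + (t : 𝕜) • z) ≤ p ((s : 𝕜) • y) + p ((t : 𝕜) • z) := map_add_le_add p _ _
    _ = s * p y + t * p z := by
      rw [map_smul_eq_mul, map_smul_eq_mul, RCLike.norm_of_nonneg hs, RCLike.norm_of_nonneg ht]
    _ ≤ s * K + t * K := by gcongr
    _ = K := by rw [← add_mul, hst, one_mul]

theorem seminorm_add_sum_le_of_unimodular (p : Seminorm 𝕜 X) (v : N → X) {K : ℝ} (A : Finset N)
    (u : X) (h : ∀ ε : N → 𝕜, (∀ n, ‖ε n‖ = 1) → p (u + ∑ n ∈ A, ε n • v n) ≤ K)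
    (lam : N → 𝕜) (hlam : ∀ n, ‖lam n‖ ≤ 1) : p (u + ∑ n ∈ A, lam n • v n) ≤ K := by
  induction A using Finset.induction_on generalizing u with
  | empty => simpa using h 1 (by simp)
  | insert a A ha ih =>
    obtain ⟨y, z, s, t, hy, hz, hs, ht, hst, hl⟩ := exists_convexComb_unimodular (hlam a)
    have key : ∀ w : 𝕜, ‖w‖ = 1 → p ((u + w • v a) + ∑ n ∈ A, lam n • v n) ≤ K := by
      intro w hw
      refine ih _ fun ε hε => ?_
      convert h (Function.update ε a w) fun n => ?_ using 2
      · rw [Finset.sum_insert ha, add_assoc]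
        congr 2
        · simp
        · refine Finset.sum_congr rfl fun n hn => ?_
          rw [Function.update_of_ne (ne_of_mem_of_not_mem hn ha)]
      · by_cases hn : n = a
        · simp [hn, hw]
        · simp [hn, hε]
    convert seminorm_convexComb_le p hs ht hst (key y hy) (key z hz) using 2
    have hst' : (s : 𝕜) + (t : 𝕜) = 1 := by exact_mod_cast hst
    rw [Finset.sum_insert ha, hl]
    have : ∀ S : X, u + (((s : 𝕜) * y + (t : 𝕜) * z) • v a + S) =
        ((s : 𝕜) + (t : 𝕜)) • (u + S) + ((s : 𝕜) * y + (t : 𝕜) * z) • v a := by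
      intro S; rw [hst']; module
    rw [this]
    module

theorem seminorm_sum_le_of_unimodular (p : Seminorm 𝕜 X) (v : N → X) {K : ℝ} (A : Finset N)
    (h : ∀ ε : N → 𝕜, (∀ n, ‖ε n‖ = 1) → p (∑ n ∈ A, ε n • v n) ≤ K)
    (lam : N → 𝕜) {M : ℝ} (hM : 0 ≤ M) (hlam : ∀ n, ‖lam n‖ ≤ M) :
    p (∑ n ∈ A, lam n • v n) ≤ M * K := by
  rcases hM.eq_or_lt with rfl | hM
  · have : ∀ n, lam n = 0 := fun n => norm_le_zero_iff.1 (hlam n)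
    simp [this]
  · have h1 := seminorm_add_sum_le_of_unimodular p v A 0 (by simpa using h)
      (fun n => (M : 𝕜)⁻¹ * lam n) fun n => by
        rw [norm_mul, norm_inv, RCLike.norm_of_nonneg hM.le, inv_mul_le_iff₀ hM]
        simpa using hlam n
    have hM' : (M : 𝕜) ≠ 0 := by exact_mod_cast hM.ne'
    calc p (∑ n ∈ A, lam n • v n)
        = p ((M : 𝕜) • (0 + ∑ n ∈ A, ((M : 𝕜)⁻¹ * lam n) • v n)) := by
          rw [zero_add, Finset.smul_sum]
          simp only [smul_smul, mul_inv_cancel_left₀ hM']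
      _ = M * p (0 + ∑ n ∈ A, ((M : 𝕜)⁻¹ * lam n) • v n) := by
          rw [map_smul_eq_mul, RCLike.norm_of_nonneg hM.le]
      _ ≤ M * K := by gcongr

theorem seminorm_add_sum_le_of_subset (p : Seminorm 𝕜 X) (v : N → X) {K : ℝ} (A : Finset N)
    (u : X) (h : ∀ S ⊆ A, p (u + ∑ n ∈ S, v n) ≤ K)
    (lam : N → ℝ) (h0 : ∀ n, 0 ≤ lam n) (h1 : ∀ n, lam n ≤ 1) :
    p (u + ∑ n ∈ A, (lam n : 𝕜) • v n) ≤ K := by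
  induction A using Finset.induction_on generalizing u with
  | empty => simpa using h ∅ subset_rfl
  | insert a A ha ih =>
    have hu := ih u fun S hS => h S (hS.trans (Finset.subset_insert a A))
    have hv := ih (u + v a) fun S hS => by
      have := h (insert a S) (Finset.insert_subset_insert a hS)
      rwa [Finset.sum_insert fun h => ha (hS h), ← add_assoc] at this
    convert seminorm_convexComb_le p (h0 a) (sub_nonneg.2 (h1 a)) (by ring) hv hu using 2
    rw [Finset.sum_insert ha]
    push_cast
    module

/-- If all partial sums of `v` over subsets of `A` have seminorm at most `K`, then multiplying
by scalars from the unit disc gives at most `4 * K`. -/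
theorem seminorm_sum_le_four_mul (p : Seminorm 𝕜 X) (v : N → X) {K : ℝ} (A : Finset N)
    (h : ∀ S ⊆ A, p (∑ n ∈ S, v n) ≤ K) (lam : N → 𝕜) (hlam : ∀ n, ‖lam n‖ ≤ 1) :
    p (∑ n ∈ A, lam n • v n) ≤ 4 * K := by
  have hK : 0 ≤ K := (apply_nonneg p _).trans (h ∅ (Finset.empty_subset A))
  have unit : ∀ c : N → ℝ, (∀ n, 0 ≤ c n) → (∀ n, c n ≤ 1) →
      p (∑ n ∈ A, (c n : 𝕜) • v n) ≤ K := fun c h0 h1 => by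
    simpa using seminorm_add_sum_le_of_subset p v A 0 (by simpa using h) c h0 h1
  have real : ∀ c : N → ℝ, (∀ n, |c n| ≤ 1) → p (∑ n ∈ A, (c n : 𝕜) • v n) ≤ 2 * K := by
    intro c hc
    have hsplit : ∑ n ∈ A, (c n : 𝕜) • v n =
        ∑ n ∈ A, ((max (c n) 0 : ℝ) : 𝕜) • v n - ∑ n ∈ A, ((max (-c n) 0 : ℝ) : 𝕜) • v n := by
      rw [← Finset.sum_sub_distrib]
      refine Finset.sum_congr rfl fun n _ => ?_
      rw [← sub_smul, ← RCLike.ofReal_sub]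
      congr 2
      rcases le_total 0 (c n) with h | h <;> simp [h]
    rw [hsplit, two_mul]
    exact (map_sub_le_add p _ _).trans (add_le_add
      (unit _ (fun n => le_max_right _ _) fun n => max_le (abs_le.1 (hc n)).2 zero_le_one)
      (unit _ (fun n => le_max_right _ _) fun n =>
        max_le (by linarith [(abs_le.1 (hc n)).1]) zero_le_one))
  have hsplit : ∑ n ∈ A, lam n • v n = ∑ n ∈ A, (RCLike.re (lam n) : 𝕜) • v n +
      (RCLike.I : 𝕜) • ∑ n ∈ A, (RCLike.im (lam n) : 𝕜) • v n := by
    rw [Finset.smul_sum, ← Finset.sum_add_distrib]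
    refine Finset.sum_congr rfl fun n _ => ?_
    rw [smul_smul, ← add_smul, mul_comm RCLike.I, RCLike.re_add_im]
  have hre := real (fun n => RCLike.re (lam n)) fun n => (RCLike.abs_re_le_norm _).trans (hlam n)
  have him := real (fun n => RCLike.im (lam n)) fun n => (RCLike.abs_im_le_norm _).trans (hlam n)
  have hI : ‖(RCLike.I : 𝕜)‖ ≤ 1 := by
    rcases RCLike.I_eq_zero_or_im_I_eq_one (K := 𝕜) with h | h
    · simp [h]
    · exact (RCLike.norm_I_of_ne_zero fun h0 => by simp [h0] at h).le
  rw [hsplit]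
  calc _ ≤ _ := map_add_le_add p _ _
    _ ≤ 2 * K + 1 * (2 * K) := by
      rw [map_smul_eq_mul]
      gcongr
    _ = 4 * K := by ring

end Convexity

variable [NormedAddCommGroup X] [NormedSpace 𝕜 X] {x : N → X} {xs : N → X →L[𝕜] 𝕜}

theorem IsBasis.coord_eq_ite (hb : IsBasis x xs) (n k : N) :
    xs n (x k) = if n = k then 1 else 0 := by
  split_ifs with h
  · rw [h, hb.biorth_diag]
  · exact hb.biorth_off n k h

theorem IsBasis.exists_norm_coord_le (hb : IsBasis x xs) : ∃ D : ℝ, ∀ n, ‖xs n‖ ≤ D := by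
  obtain ⟨c, hc, hcx⟩ := hb.norm_pos
  obtain ⟨D, hD⟩ := hb.mBounded
  refine ⟨D / c, fun n => ?_⟩
  rw [le_div_iff₀' hc]
  exact (mul_le_mul_of_nonneg_right (hcx n) (norm_nonneg _)).trans (hD n)

/-- A greedy basis is suppression unconditional. -/
theorem IsBasis.norm_sub_greedyProj_le (hb : IsBasis x xs) {C : ℝ}
    (hg : GreedyWith (fun f : X => ‖f‖) x xs C) (f : X) (A : Finset N) :
    ‖f - greedyProj x xs A f‖ ≤ C * ‖f‖ := by
  obtain ⟨D, hD⟩ := hb.exists_norm_coord_le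
  obtain ⟨t, ht⟩ : ∃ t : ℝ, 0 ≤ t ∧ ∀ n, ‖xs n f‖ ≤ t :=
    ⟨|D| * ‖f‖, by positivity, fun n => ((xs n).le_opNorm f).trans
      (mul_le_mul_of_nonneg_right ((hD n).trans (le_abs_self D)) (norm_nonneg f))⟩
  set g : X := f + ∑ n ∈ A, ((t : 𝕜) - xs n f) • x n with hgdef
  have hcoord : ∀ k, xs k g = if k ∈ A then (t : 𝕜) else xs k f := by
    intro k
    simp only [hgdef, map_add, map_sum, map_smul, hb.coord_eq_ite, smul_eq_mul, mul_ite, mul_one,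
      mul_zero, Finset.sum_ite_eq]
    split_ifs <;> ring
  have hgreedy : GreedySet xs g A := by
    intro n hn k hk
    rw [hcoord, hcoord, if_pos hn, if_neg hk, RCLike.norm_of_nonneg ht.1]
    exact ht.2 k
  have := hg g A A (fun n => (t : 𝕜) - xs n f) hgreedy le_rfl
  simp only at this
  have h1 : g - greedyProj x xs A g = f - greedyProj x xs A f := by
    have : greedyProj x xs A g = ∑ n ∈ A, (t : 𝕜) • x n :=
      Finset.sum_congr rfl fun n hn => by rw [hcoord, if_pos hn]
    rw [this, hgdef, greedyProj]
    simp only [sub_smul, Finset.sum_sub_distrib]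
    abel
  rwa [h1, hgdef, add_sub_cancel_right] at this

variable (x xs) in
/-- The operator multiplying the coordinates in the finite set `F` by the scalars `ε`. -/
def coordMul (F : Finset N) (ε : N → 𝕜) : X →ₗ[𝕜] X :=
  LinearMap.id + ∑ n ∈ F, (ε n - 1) • (xs n : X →ₗ[𝕜] 𝕜).smulRight (x n)

theorem coordMul_apply (F : Finset N) (ε : N → 𝕜) (f : X) :
    coordMul x xs F ε f = f + ∑ n ∈ F, (ε n - 1) • xs n f • x n := by
  simp [coordMul, LinearMap.sum_apply]

theorem IsBasis.coordMul_basis (hb : IsBasis x xs) (F : Finset N) (ε : N → 𝕜) (k : N) :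
    coordMul x xs F ε (x k) = (if k ∈ F then ε k else 1) • x k := by
  simp only [coordMul_apply, hb.coord_eq_ite, ite_smul, one_smul, zero_smul, smul_ite, smul_zero,
    Finset.sum_ite_eq']
  split_ifs
  · module
  · simp

theorem IsBasis.coord_coordMul (hb : IsBasis x xs) (F : Finset N) (ε : N → 𝕜) (k : N) (f : X) :
    xs k (coordMul x xs F ε f) = (if k ∈ F then ε k else 1) * xs k f := by
  simp only [coordMul_apply, map_add, map_sum, map_smul, hb.coord_eq_ite, smul_eq_mul, mul_ite,
    mul_one, mul_zero, Finset.sum_ite_eq]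
  split_ifs <;> ring

theorem norm_ite_unimodular {ε : N → 𝕜} (hε : ∀ n, ‖ε n‖ = 1) (F : Finset N) (k : N) :
    ‖(if k ∈ F then ε k else 1 : 𝕜)‖ = 1 := by
  split_ifs <;> simp [hε]

theorem IsBasis.norm_coordMul_le (hb : IsBasis x xs) {C : ℝ}
    (hg : GreedyWith (fun f : X => ‖f‖) x xs C) (F : Finset N) {ε : N → 𝕜}
    (hε : ∀ n, ‖ε n‖ = 1) (f : X) :
    ‖coordMul x xs F ε f‖ ≤ (5 * C + 4) * ‖f‖ := by
  have hproj : ∀ S ⊆ F, normSeminorm 𝕜 X (∑ n ∈ S, xs n f • x n) ≤ (C + 1) * ‖f‖ := by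
    intro S _
    have h := hb.norm_sub_greedyProj_le hg f S
    have h' := norm_sub_norm_le (greedyProj x xs S f) f
    rw [norm_sub_rev] at h'
    change ‖greedyProj x xs S f‖ ≤ _
    linarith
  have hmul := seminorm_sum_le_four_mul (normSeminorm 𝕜 X) _ F hproj ε fun n => (hε n).le
  have heq : coordMul x xs F ε f = (f - greedyProj x xs F f) + ∑ n ∈ F, ε n • xs n f • x n := by
    simp only [coordMul_apply, greedyProj, sub_smul, Finset.sum_sub_distrib, one_smul]
    abel
  rw [heq]
  have h2 := norm_add_le (f - greedyProj x xs F f) (∑ n ∈ F, ε n • xs n f • x n)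
  have h3 := hb.norm_sub_greedyProj_le hg f F
  simp only [coe_normSeminorm] at hmul
  linarith

variable (𝕜 N) in
/-- Finitely supported changes of sign. -/
abbrev SignChange : Type _ := Finset N × {ε : N → 𝕜 // ∀ n, ‖ε n‖ = 1}

variable (x xs) in
/-- The seminorm `f ↦ sup ‖T f‖`, where `T` runs over the finitely supported sign changes. -/
def signNorm : Seminorm 𝕜 X :=
  ⨆ i : SignChange 𝕜 N, (normSeminorm 𝕜 X).comp (coordMul x xs i.1 i.2.1)

section SignNorm

variable (hb : IsBasis x xs) {C : ℝ} (hC : 1 ≤ C) (hg : GreedyWith (fun f : X => ‖f‖) x xs C)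

include hb hC hg

theorem bddAbove_signNorm :
    BddAbove (Set.range fun i : SignChange 𝕜 N =>
      (normSeminorm 𝕜 X).comp (coordMul x xs i.1 i.2.1)) := by
  refine ⟨NNReal.mk (5 * C + 4) (by linarith) • normSeminorm 𝕜 X, ?_⟩
  rintro _ ⟨i, rfl⟩ f
  exact hb.norm_coordMul_le hg i.1 i.2.2 f

theorem norm_coordMul_le_signNorm (F : Finset N) {ε : N → 𝕜} (hε : ∀ n, ‖ε n‖ = 1) (f : X) :
    ‖coordMul x xs F ε f‖ ≤ signNorm x xs f :=
  le_ciSup (bddAbove_signNorm hb hC hg) (⟨F, ε, hε⟩ : SignChange 𝕜 N) f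

theorem signNorm_le {f : X} {K : ℝ}
    (h : ∀ (F : Finset N) (ε : N → 𝕜), (∀ n, ‖ε n‖ = 1) → ‖coordMul x xs F ε f‖ ≤ K) :
    signNorm x xs f ≤ K := by
  have : Nonempty (SignChange 𝕜 N) := ⟨⟨∅, 1, by simp⟩⟩
  rw [signNorm, Seminorm.iSup_apply (bddAbove_signNorm hb hC hg)]
  exact ciSup_le fun i => h i.1 i.2.1 i.2.2

theorem norm_le_signNorm (f : X) : ‖f‖ ≤ signNorm x xs f := by
  simpa [coordMul_apply] using
    norm_coordMul_le_signNorm hb hC hg ∅ (ε := 1) (by simp) f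

theorem signNorm_le_mul_norm (f : X) : signNorm x xs f ≤ (5 * C + 4) * ‖f‖ :=
  signNorm_le hb hC hg fun F _ hε => hb.norm_coordMul_le hg F hε f

theorem continuous_signNorm : Continuous (signNorm x xs) := by
  refine Seminorm.continuous_of_le (q := NNReal.mk (5 * C + 4) (by linarith) • normSeminorm 𝕜 X)
    ?_ fun f => signNorm_le_mul_norm hb hC hg f
  change Continuous fun f : X => (5 * C + 4) * ‖f‖
  fun_prop

theorem isEquivNorm_signNorm : IsEquivNorm 𝕜 (signNorm x xs) where
  add_le := map_add_le_add _
  smul_eq := map_smul_eq_mul _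
  lower := ⟨1, one_pos, fun f => by simpa using norm_le_signNorm hb hC hg f⟩
  upper := ⟨5 * C + 4, by linarith, signNorm_le_mul_norm hb hC hg⟩

theorem signNorm_sum_unimodular_le (F : Finset N) (c ε : N → 𝕜) (hε : ∀ n, ‖ε n‖ = 1) :
    signNorm x xs (∑ n ∈ F, ε n • c n • x n) ≤ signNorm x xs (∑ n ∈ F, c n • x n) := by
  refine signNorm_le hb hC hg fun G δ hδ => ?_
  convert norm_coordMul_le_signNorm hb hC hg F
    (ε := fun n => (if n ∈ G then δ n else 1) * ε n)
    (fun n => by rw [norm_mul, norm_ite_unimodular hδ, hε, one_mul]) _ using 2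
  simp only [map_sum, map_smul, hb.coordMul_basis]
  refine Finset.sum_congr rfl fun n hn => ?_
  rw [if_pos hn]
  module

theorem latticeUnconditionalWith_signNorm :
    LatticeUnconditionalWith (signNorm x xs) x xs 1 := by
  intro f A lam M hlam
  rw [one_mul]
  have hdense : Dense (Submodule.span 𝕜 (Set.range x) : Set X) :=
    Submodule.dense_iff_topologicalClosure_eq_top.2 hb.dense_span
  have hcont := continuous_signNorm hb hC hg
  refine hdense.induction (P := fun f => signNorm x xs (∑ n ∈ A, lam n • xs n f • x n) ≤
    M * signNorm x xs f) (fun f hf => ?_) (isClosed_le (by fun_prop) (by fun_prop)) f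
  obtain ⟨c, rfl⟩ := Finsupp.mem_span_range_iff_exists_finsupp.1 hf
  rcases isEmpty_or_nonempty N with hN | ⟨⟨n₀⟩⟩
  · simp [Finset.eq_empty_of_isEmpty, Subsingleton.elim c 0]
  have hM : 0 ≤ M := (norm_nonneg _).trans (hlam n₀)
  have hcoord : ∀ n, xs n (c.sum fun i a => a • x i) = c n := by
    intro n
    simp only [Finsupp.sum, map_sum, map_smul, hb.coord_eq_ite, smul_eq_mul, mul_ite, mul_one,
      mul_zero, Finset.sum_ite_eq]
    simpa using Eq.symm
  have hrew : ∑ n ∈ A, lam n • xs n (c.sum fun i a => a • x i) • x n =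
      ∑ n ∈ c.support, (if n ∈ A then lam n else 0) • c n • x n := by
    simp only [hcoord, ite_smul, zero_smul, ← Finset.sum_filter]
    refine (Finset.sum_subset (fun n hn => (Finset.mem_filter.1 hn).2) fun n hn hn' => ?_).symm
    simp only [Finset.mem_filter, Finsupp.mem_support_iff, not_and] at hn'
    have : c n = 0 := by_contra fun h => hn' h hn
    simp [this]
  rw [hrew]
  refine seminorm_sum_le_of_unimodular (signNorm x xs) _ _
    (fun ε hε => signNorm_sum_unimodular_le hb hC hg _ _ ε hε) _ hM fun n => ?_
  split_ifs
  · exact hlam n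
  · simpa using hM

theorem greedyWith_signNorm : GreedyWith (signNorm x xs) x xs C := by
  intro f A B a hA hBA
  refine signNorm_le hb hC hg fun F ε hε => ?_
  have hgreedy : GreedySet xs (coordMul x xs F ε f) A := by
    intro n hn k hk
    simpa only [hb.coord_coordMul, norm_mul, norm_ite_unimodular hε, one_mul] using hA n hn k hk
  have h := hg _ A B (fun n => a n * if n ∈ F then ε n else 1) hgreedy hBA
  have h1 : greedyProj x xs A (coordMul x xs F ε f) =
      coordMul x xs F ε (greedyProj x xs A f) := by
    simp only [greedyProj, map_sum, map_smul, hb.coordMul_basis, hb.coord_coordMul, smul_smul,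
      mul_comm]
  have h2 : ∑ n ∈ B, (a n * if n ∈ F then ε n else 1) • x n =
      coordMul x xs F ε (∑ n ∈ B, a n • x n) := by
    simp only [map_sum, map_smul, hb.coordMul_basis, smul_smul]
  simp only [h1, h2, ← map_sub] at h
  exact h.trans (mul_le_mul_of_nonneg_left (norm_coordMul_le_signNorm hb hC hg F hε _)
    (by linarith))

end SignNorm

theorem norm_sum_unimodular_le {Y : Type*} [SeminormedAddCommGroup Y] [NormedSpace 𝕜 Y]
    {y : N → Y} {D : ℝ} (hy : ∀ n, ‖y n‖ ≤ D) {m : ℕ} {A : Finset N} (hA : A.card ≤ m)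
    {ε : N → 𝕜} (hε : ∀ n, ‖ε n‖ = 1) : ‖∑ n ∈ A, ε n • y n‖ ≤ m * |D| :=
  calc ‖∑ n ∈ A, ε n • y n‖ ≤ ∑ n ∈ A, ‖ε n • y n‖ := norm_sum_le _ _
    _ ≤ ∑ _n ∈ A, |D| := Finset.sum_le_sum fun n _ => by
      rw [norm_smul, hε, one_mul]
      exact (hy n).trans (le_abs_self D)
    _ = A.card * |D| := by simp
    _ ≤ m * |D| := by gcongr

theorem norm_sum_le_fundFun {Y : Type*} [SeminormedAddCommGroup Y] [NormedSpace 𝕜 Y]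
    {y : N → Y} {D : ℝ} (hy : ∀ n, ‖y n‖ ≤ D) {m : ℕ} {A : Finset N} (hA : A.card ≤ m)
    {ε : N → 𝕜} (hε : ∀ n, ‖ε n‖ = 1) : ‖∑ n ∈ A, ε n • y n‖ ≤ fundFun 𝕜 y m := by
  refine le_csSup ⟨m * |D|, ?_⟩ ⟨A, ε, hA, hε, rfl⟩
  rintro _ ⟨A, ε, hA, hε, rfl⟩
  exact norm_sum_unimodular_le hy hA hε

theorem fundFunWith_signNorm (hb : IsBasis x xs) {C : ℝ} (hC : 1 ≤ C)
    (hg : GreedyWith (fun f : X => ‖f‖) x xs C) (m : ℕ) :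
    fundFunWith 𝕜 (signNorm x xs) x m = fundFun 𝕜 x m := by
  obtain ⟨D, hD⟩ := hb.norm_bdd
  have hle : ∀ r ∈ {r : ℝ | ∃ (A : Finset N) (ε : N → 𝕜), A.card ≤ m ∧ (∀ n, ‖ε n‖ = 1) ∧
      r = signNorm x xs (∑ n ∈ A, ε n • x n)}, r ≤ fundFun 𝕜 x m := by
    rintro _ ⟨A, ε, hA, hε, rfl⟩
    refine signNorm_le hb hC hg fun F δ hδ => ?_
    simp only [map_sum, map_smul, hb.coordMul_basis, smul_smul]
    exact norm_sum_le_fundFun hD hA fun n => by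
      rw [norm_mul, norm_ite_unimodular hδ, hε, one_mul]
  apply le_antisymm
  · exact csSup_le ⟨_, ∅, 1, by simp, by simp, rfl⟩ hle
  · refine csSup_le ⟨_, ∅, 1, by simp, by simp, rfl⟩ ?_
    rintro _ ⟨A, ε, hA, hε, rfl⟩
    exact (norm_le_signNorm hb hC hg _).trans (le_csSup ⟨_, hle⟩ ⟨A, ε, hA, hε, rfl⟩)

theorem dualNormWith_le_norm {ν : X → ℝ} (h0 : ν 0 = 0) (hν : ∀ f, ‖f‖ ≤ ν f)
    (g : X →L[𝕜] 𝕜) : dualNormWith ν g ≤ ‖g‖ := by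
  refine csSup_le ⟨_, 0, by simp [h0], rfl⟩ ?_
  rintro _ ⟨f, hf, rfl⟩
  exact g.unit_le_opNorm f ((hν f).trans hf)

theorem dualFundFunWith_le_fundFun (hb : IsBasis x xs) {ν : X → ℝ} (h0 : ν 0 = 0)
    (hν : ∀ f, ‖f‖ ≤ ν f) (m : ℕ) : dualFundFunWith ν xs m ≤ fundFun 𝕜 xs m := by
  obtain ⟨D, hD⟩ := hb.exists_norm_coord_le
  refine csSup_le ⟨_, ∅, 1, by simp, by simp, rfl⟩ ?_
  rintro _ ⟨B, δ, hB, hδ, rfl⟩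
  exact (dualNormWith_le_norm h0 hν _).trans (norm_sum_le_fundFun hD hB hδ)

end Renorming

/-- Lemma 4.1: a `C`-greedy basis admits a renorming which is lattice
`1`-unconditional and `C`-greedy, preserving the fundamental function and not increasing
the dual fundamental function. -/
theorem greedy_lattice_unconditional_renorming {𝕜 : Type*} [RCLike 𝕜] {N : Type*}
    [Countable N] {X : Type*} [NormedAddCommGroup X] [NormedSpace 𝕜 X] [CompleteSpace X]
    (x : N → X) (xs : N → X →L[𝕜] 𝕜) (hb : IsBasis x xs)
    (C : ℝ) (hC : 1 ≤ C) (hg : GreedyWith (fun f : X => ‖f‖) x xs C) :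
    ∃ ν : X → ℝ, IsEquivNorm 𝕜 ν ∧ LatticeUnconditionalWith ν x xs 1 ∧
      GreedyWith ν x xs C ∧
      (∀ m : ℕ, 1 ≤ m → fundFunWith 𝕜 ν x m = fundFun 𝕜 x m) ∧
      (∀ m : ℕ, 1 ≤ m → dualFundFunWith ν xs m ≤ fundFun 𝕜 xs m) := by
  exact ⟨signNorm x xs, isEquivNorm_signNorm hb hC hg, latticeUnconditionalWith_signNorm hb hC hg,
    greedyWith_signNorm hb hC hg, fun m _ => fundFunWith_signNorm hb hC hg m,
    fun m _ => dualFundFunWith_le_fundFun hb (map_zero _) (norm_le_signNorm hb hC hg) m⟩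

end GreedyRenorm
end
end

section
/- Let X = (x_n)_{n∈ℕ} be a C-greedy basis of a real or complex Banach space X, C ≥ 1, and assume that X is subsymmetric. Then X admits an equivalent norm with respect to which X is isometrically subsymmetric and C-greedy; moreover, the equivalent norm can be chosen so that the fundamental function ψ of X relative to it satisfies ψ ≤ φ_u[X], and the fundamental function ψ* of the dual system relative to the dual of the new norm satisfies ψ* ≤ φ_u[X*]. -/
open scoped BigOperators ENNReal NNReal
open MeasureTheory

noncomputable section

namespace GreedyRenorm

section DilatedSigns

variable {𝕜 : Type*} [RCLike 𝕜] {X : Type*} [NormedAddCommGroup X] [NormedSpace 𝕜 X]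

/-- `T` is the dilated sign change `x n ↦ lam n • x (β n)`. -/
structure IsDilatedSign (x : ℕ → X) (lam : ℕ → 𝕜) (β : ℕ → ℕ) (T : X →L[𝕜] X) : Prop where
  norm_eq : ∀ n, ‖lam n‖ = 1
  strictMono : StrictMono β
  map_basis : ∀ n, T (x n) = lam n • x (β n)

/-- The dilated sign changes whose dilation takes only positive multiples of `k !`. -/
def sparseDilations (𝕜 : Type*) [RCLike 𝕜] {X : Type*} [NormedAddCommGroup X]
    [NormedSpace 𝕜 X] (x : ℕ → X) (k : ℕ) : Set (X →L[𝕜] X) :=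
  {T | ∃ lam β, IsDilatedSign x lam β T ∧ ∀ n, 0 < β n ∧ k.factorial ∣ β n}

/-- The supremum of `‖T f‖` over the dilated sign changes of sparsity `k`. -/
def sparseSup (𝕜 : Type*) [RCLike 𝕜] {X : Type*} [NormedAddCommGroup X]
    [NormedSpace 𝕜 X] (x : ℕ → X) (k : ℕ) (f : X) : ℝ :=
  sSup ((fun T : X →L[𝕜] X => ‖T f‖) '' sparseDilations 𝕜 x k)

/-- The limit of the norms `sparseSup 𝕜 x k` as the dilations become sparser. -/
def spreadNorm (𝕜 : Type*) [RCLike 𝕜] {X : Type*} [NormedAddCommGroup X]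
    [NormedSpace 𝕜 X] (x : ℕ → X) (f : X) : ℝ :=
  ⨅ k, sparseSup 𝕜 x k f

/-- A sufficiently sparse sequence factors, on an initial segment, through any given
dilation. -/
theorem exists_sparse_factorization {γ : ℕ → ℕ} (hγ : StrictMono γ) (N k : ℕ) :
    ∃ k' : ℕ, ∀ β : ℕ → ℕ, StrictMono β → (∀ n, 0 < β n ∧ k'.factorial ∣ β n) →
      ∃ β' : ℕ → ℕ, StrictMono β' ∧ (∀ n, 0 < β' n ∧ k.factorial ∣ β' n) ∧
        ∀ n < N, β' (γ n) = β n := by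
  refine ⟨k + (γ N + 1), fun β hβ hdiv => ?_⟩
  set L := γ N + 1 with hL
  have hd : ∀ n, k.factorial * L ∣ β n := fun n =>
    ((mul_dvd_mul_left _ (Nat.dvd_factorial (by omega) le_rfl)).trans
      (Nat.factorial_mul_factorial_dvd_factorial_add k L)).trans (hdiv n).2
  choose b hb using hd
  have hk : 0 < k.factorial := Nat.factorial_pos k
  have hb_pos : ∀ n, 0 < b n := fun n => by
    have h := (hdiv n).1
    rw [hb n] at h
    exact Nat.pos_of_mul_pos_left h
  have hb_mono : StrictMono b := fun i j hij => by
    have h := hβ hij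
    rw [hb i, hb j] at h
    exact lt_of_mul_lt_mul_left h (Nat.zero_le _)
  let e : ℕ → ℕ := fun n => L * b n - 1 - γ n
  have he : ∀ i j, i ≤ j → j < N → e i ≤ e j := fun i j hij hj => by
    rcases hij.eq_or_lt with rfl | hij
    · exact le_rfl
    have h1 : b i + 1 ≤ b j := hb_mono hij
    have h2 : L * (b i + 1) ≤ L * b j := Nat.mul_le_mul_left _ h1
    have h3 : γ j < γ N := hγ hj
    have h4 : L * (b i + 1) = L * b i + L := by ring
    simp only [e]
    omega
  let h : ℕ → ℕ := fun m => ((Finset.range N).filter (fun i => γ i ≤ m)).sup e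
  have hh : Monotone h := fun m m' hm => Finset.sup_mono fun i hi => by
    simp only [Finset.mem_filter] at hi ⊢
    exact ⟨hi.1, hi.2.trans hm⟩
  refine ⟨fun m => k.factorial * (m + 1 + h m), fun i j hij => ?_, fun n => ⟨?_, ?_⟩,
    fun n hn => ?_⟩
  · have := hh hij.le
    exact Nat.mul_lt_mul_of_pos_left (by omega) hk
  · positivity
  · exact dvd_mul_right _ _
  · have h1 : h (γ n) = e n := by
      refine le_antisymm (Finset.sup_le fun i hi => ?_) (Finset.le_sup (f := e) ?_)
      · simp only [Finset.mem_filter] at hi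
        exact he i n (hγ.le_iff_le.1 hi.2) hn
      · simp [hn]
    have h2 : γ n < γ N := hγ hn
    have h3 : L * 1 ≤ L * b n := Nat.mul_le_mul_left _ (hb_pos n)
    have h4 : γ n + 1 + e n = L * b n := by simp only [e]; omega
    simp only [h1, h4, hb n, mul_assoc]

theorem IsBasis.dense {N : Type*} {x : N → X} {xs : N → X →L[𝕜] 𝕜} (hb : IsBasis x xs) :
    Dense (Submodule.span 𝕜 (Set.range x) : Set X) :=
  Submodule.dense_iff_topologicalClosure_eq_top.2 hb.dense_span

theorem IsBasis.map_ext {N Y : Type*} {x : N → X} {xs : N → X →L[𝕜] 𝕜}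
    [NormedAddCommGroup Y] [NormedSpace 𝕜 Y] (hb : IsBasis x xs) {S T : X →L[𝕜] Y}
    (h : ∀ n, S (x n) = T (x n)) : S = T :=
  ContinuousLinearMap.ext_on hb.dense (by rintro _ ⟨n, rfl⟩; exact h n)

theorem IsBasis.exists_norm_dual_le {N : Type*} {x : N → X} {xs : N → X →L[𝕜] 𝕜}
    (hb : IsBasis x xs) : ∃ K : ℝ, ∀ n, ‖xs n‖ ≤ K := by
  obtain ⟨c, hc, hcx⟩ := hb.norm_pos
  obtain ⟨M, hM⟩ := hb.mBounded
  refine ⟨M / c, fun n => ?_⟩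
  rw [le_div_iff₀ hc]
  nlinarith [hM n, hcx n, norm_nonneg (xs n)]

theorem norm_signed_sum_le_fundFun {N Y : Type*} [NormedAddCommGroup Y] [NormedSpace 𝕜 Y]
    {y : N → Y} {K : ℝ} (hK : ∀ n, ‖y n‖ ≤ K) {m : ℕ} {A : Finset N} {ε : N → 𝕜}
    (hA : A.card ≤ m) (hε : ∀ n, ‖ε n‖ = 1) :
    ‖∑ n ∈ A, ε n • y n‖ ≤ fundFun 𝕜 y m := by
  refine le_csSup ⟨m * |K|, ?_⟩ ⟨A, ε, hA, hε, rfl⟩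
  rintro _ ⟨B, δ, hB, hδ, rfl⟩
  calc ‖∑ n ∈ B, δ n • y n‖ ≤ ∑ n ∈ B, |K| := norm_sum_le_of_le _ fun n _ => by
        rw [norm_smul, hδ, one_mul]; exact (hK n).trans (le_abs_self K)
    _ = B.card * |K| := by simp
    _ ≤ m * |K| := by gcongr

theorem exists_initial_determining (x : ℕ → X) {f : X}
    (hf : f ∈ Submodule.span 𝕜 (Set.range x)) :
    ∃ N : ℕ, ∀ S T : X →L[𝕜] X, (∀ n < N, S (x n) = T (x n)) → S f = T f := by
  induction hf using Submodule.span_induction with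
  | mem y hy =>
    obtain ⟨n, rfl⟩ := hy
    exact ⟨n + 1, fun S T h => h n n.lt_succ_self⟩
  | zero => exact ⟨0, fun S T _ => by simp⟩
  | add f g _ _ hf hg =>
    obtain ⟨M, hM⟩ := hf
    obtain ⟨N, hN⟩ := hg
    refine ⟨max M N, fun S T h => ?_⟩
    rw [map_add, map_add, hM S T fun n hn => h n (lt_max_of_lt_left hn),
      hN S T fun n hn => h n (lt_max_of_lt_right hn)]
  | smul a f _ hf =>
    obtain ⟨N, hN⟩ := hf
    exact ⟨N, fun S T h => by rw [map_smul, map_smul, hN S T h]⟩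

namespace IsDilatedSign

variable {x : ℕ → X} {xs : ℕ → X →L[𝕜] 𝕜} {lam mu : ℕ → 𝕜} {β γ : ℕ → ℕ} {T U : X →L[𝕜] X}

theorem comp (hU : IsDilatedSign x lam β U) (hT : IsDilatedSign x mu γ T) :
    IsDilatedSign x (fun n => mu n * lam (γ n)) (fun n => β (γ n)) (U.comp T) where
  norm_eq n := by rw [norm_mul, hU.norm_eq, hT.norm_eq, one_mul]
  strictMono := hU.strictMono.comp hT.strictMono
  map_basis n := by simp [hT.map_basis, hU.map_basis, smul_smul]

theorem coord_apply (hb : IsBasis x xs) (hT : IsDilatedSign x lam β T) (n : ℕ) (f : X) :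
    xs (β n) (T f) = lam n * xs n f := by
  have : (xs (β n)).comp T = lam n • xs n := hb.map_ext fun k => by
    simp only [ContinuousLinearMap.comp_apply, hT.map_basis, map_smul, smul_eq_mul,
      smul_apply]
    rcases eq_or_ne n k with rfl | h
    · simp [hb.biorth_diag]
    · simp [hb.biorth_off _ _ h, hb.biorth_off _ _ (hT.strictMono.injective.ne h)]
  exact DFunLike.congr_fun this f

theorem coord_apply_of_notMem (hb : IsBasis x xs) (hT : IsDilatedSign x lam β T) {m : ℕ}
    (hm : m ∉ Set.range β) (f : X) : xs m (T f) = 0 := by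
  have : (xs m).comp T = 0 := hb.map_ext fun k => by
    have hk : m ≠ β k := fun h => hm ⟨k, h.symm⟩
    simp [hT.map_basis, hb.biorth_off _ _ hk]
  exact DFunLike.congr_fun this f

theorem map_greedyProj (hb : IsBasis x xs) (hT : IsDilatedSign x lam β T)
    (A : Finset ℕ) (f : X) :
    T (greedyProj x xs A f) = greedyProj x xs (A.image β) (T f) := by
  rw [greedyProj, greedyProj, Finset.sum_image hT.strictMono.injective.injOn, map_sum]
  refine Finset.sum_congr rfl fun n _ => ?_
  rw [map_smul, hT.map_basis, hT.coord_apply hb, smul_smul, mul_comm]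

theorem map_sum_smul (hT : IsDilatedSign x lam β T) (B : Finset ℕ) (a : ℕ → 𝕜) :
    T (∑ n ∈ B, a n • x n) = ∑ m ∈ B.image β,
      (a (Function.invFun β m) * lam (Function.invFun β m)) • x m := by
  rw [Finset.sum_image hT.strictMono.injective.injOn, map_sum]
  refine Finset.sum_congr rfl fun n _ => ?_
  rw [Function.leftInverse_invFun hT.strictMono.injective n, map_smul, hT.map_basis, smul_smul]

theorem greedySet_image (hb : IsBasis x xs) (hT : IsDilatedSign x lam β T)
    {A : Finset ℕ} {f : X} (hA : GreedySet xs f A) :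
    GreedySet xs (T f) (A.image β) := by
  intro m hm k hk
  obtain ⟨n, hn, rfl⟩ := Finset.mem_image.1 hm
  by_cases hr : k ∈ Set.range β
  · obtain ⟨j, rfl⟩ := hr
    rw [hT.coord_apply hb, hT.coord_apply hb, norm_mul, norm_mul, hT.norm_eq, hT.norm_eq,
      one_mul, one_mul]
    exact hA n hn j fun hj => hk (Finset.mem_image_of_mem β hj)
  · rw [hT.coord_apply_of_notMem hb hr, norm_zero]
    exact norm_nonneg _

theorem greedy_le (hb : IsBasis x xs) (hT : IsDilatedSign x lam β T) {C : ℝ}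
    (hg : GreedyWith (fun f : X => ‖f‖) x xs C) {f : X} {A B : Finset ℕ} (a : ℕ → 𝕜)
    (hA : GreedySet xs f A) (hBA : B.card ≤ A.card) :
    ‖T (f - greedyProj x xs A f)‖ ≤ C * ‖T (f - ∑ n ∈ B, a n • x n)‖ := by
  rw [map_sub, map_sub, hT.map_greedyProj hb, hT.map_sum_smul]
  refine hg _ _ _ _ (hT.greedySet_image hb hA) ?_
  rwa [Finset.card_image_of_injective _ hT.strictMono.injective,
    Finset.card_image_of_injective _ hT.strictMono.injective]

theorem norm_map_signed_sum_le (hT : IsDilatedSign x lam β T) {K : ℝ} (hK : ∀ n, ‖x n‖ ≤ K)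
    {m : ℕ} {A : Finset ℕ} {ε : ℕ → 𝕜} (hA : A.card ≤ m) (hε : ∀ n, ‖ε n‖ = 1) :
    ‖T (∑ n ∈ A, ε n • x n)‖ ≤ fundFun 𝕜 x m := by
  rw [hT.map_sum_smul]
  exact norm_signed_sum_le_fundFun hK (Finset.card_image_le.trans hA) fun n => by
    rw [norm_mul, hε, hT.norm_eq, one_mul]

theorem norm_dual_signed_sum_le (hb : IsBasis x xs) (hT : IsDilatedSign x lam β T)
    {m : ℕ} {B : Finset ℕ} {δ : ℕ → 𝕜} (hB : B.card ≤ m) (hδ : ∀ n, ‖δ n‖ = 1) (f : X) :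
    ‖(∑ n ∈ B, δ n • xs n) f‖ ≤ fundFun 𝕜 xs m * ‖T f‖ := by
  obtain ⟨K, hK⟩ := hb.exists_norm_dual_le
  have hinj := hT.strictMono.injective
  have key : (∑ n ∈ B, δ n • xs n) f = (∑ j ∈ B.image β,
      (δ (Function.invFun β j) * (lam (Function.invFun β j))⁻¹) • xs j) (T f) := by
    rw [Finset.sum_image hinj.injOn]
    simp only [sum_apply, smul_apply, smul_eq_mul]
    refine Finset.sum_congr rfl fun n _ => ?_
    have hne : lam n ≠ 0 := norm_ne_zero_iff.1 (by rw [hT.norm_eq]; exact one_ne_zero)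
    rw [Function.leftInverse_invFun hinj n, hT.coord_apply hb]
    field_simp
  rw [key]
  refine (ContinuousLinearMap.le_opNorm _ _).trans
    (mul_le_mul_of_nonneg_right ?_ (norm_nonneg _))
  exact norm_signed_sum_le_fundFun hK (Finset.card_image_le.trans hB) fun n => by
    rw [norm_mul, norm_inv, hδ, hT.norm_eq, inv_one, one_mul]

theorem bounds (hb : IsBasis x xs) (hT : IsDilatedSign x lam β T) {D : ℝ}
    (hD : SubsymWith 𝕜 (fun f : X => ‖f‖) x D) (f : X) :
    ‖T f‖ ≤ D * ‖f‖ ∧ ‖f‖ ≤ D * ‖T f‖ := by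
  obtain ⟨S, hS, h1, h2⟩ := hD lam hT.norm_eq β hT.strictMono
  obtain rfl : T = S := hb.map_ext fun n => by rw [hT.map_basis, hS]
  exact ⟨h1 f, h2 f⟩

end IsDilatedSign

variable {x : ℕ → X} {xs : ℕ → X →L[𝕜] 𝕜} {D : ℝ}

theorem sparseDilations_antitone (x : ℕ → X) : Antitone (sparseDilations 𝕜 x) := by
  rintro k k' hk T ⟨lam, β, hT, hβ⟩
  exact ⟨lam, β, hT, fun n => ⟨(hβ n).1, (Nat.factorial_dvd_factorial hk).trans (hβ n).2⟩⟩

theorem sparseDilations_nonempty (hD : SubsymWith 𝕜 (fun f : X => ‖f‖) x D) (k : ℕ) :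
    (sparseDilations 𝕜 x k).Nonempty := by
  have hβ : StrictMono fun n => k.factorial * (n + 1) := fun i j hij =>
    Nat.mul_lt_mul_of_pos_left (by omega) k.factorial_pos
  obtain ⟨T, hT, -⟩ := hD (fun _ => 1) (by simp) _ hβ
  exact ⟨T, _, _, ⟨by simp, hβ, hT⟩, fun n =>
    ⟨Nat.mul_pos k.factorial_pos n.succ_pos, dvd_mul_right _ _⟩⟩

theorem norm_apply_le_sparseSup (hb : IsBasis x xs)
    (hD : SubsymWith 𝕜 (fun f : X => ‖f‖) x D) {k : ℕ} {T : X →L[𝕜] X}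
    (hT : T ∈ sparseDilations 𝕜 x k) (f : X) : ‖T f‖ ≤ sparseSup 𝕜 x k f := by
  refine le_csSup ⟨D * ‖f‖, ?_⟩ ⟨T, hT, rfl⟩
  rintro _ ⟨S, ⟨lam, β, hS, -⟩, rfl⟩
  exact (hS.bounds hb hD f).1

theorem sparseSup_le (hD : SubsymWith 𝕜 (fun f : X => ‖f‖) x D) {k : ℕ} {f : X} {r : ℝ}
    (h : ∀ T ∈ sparseDilations 𝕜 x k, ‖T f‖ ≤ r) : sparseSup 𝕜 x k f ≤ r :=
  csSup_le ((sparseDilations_nonempty hD k).image _) (by rintro _ ⟨T, hT, rfl⟩; exact h T hT)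

theorem sparseSup_nonneg (k : ℕ) (f : X) : 0 ≤ sparseSup 𝕜 x k f :=
  Real.sSup_nonneg (by rintro _ ⟨T, -, rfl⟩; exact norm_nonneg _)

theorem spreadNorm_le_sparseSup (k : ℕ) (f : X) : spreadNorm 𝕜 x f ≤ sparseSup 𝕜 x k f :=
  ciInf_le ⟨0, by rintro _ ⟨k, rfl⟩; exact sparseSup_nonneg k f⟩ k

theorem tendsto_sparseSup (hb : IsBasis x xs) (hD : SubsymWith 𝕜 (fun f : X => ‖f‖) x D)
    (f : X) : Filter.Tendsto (fun k => sparseSup 𝕜 x k f) Filter.atTop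
      (nhds (spreadNorm 𝕜 x f)) :=
  tendsto_atTop_ciInf
    (fun _ _ hk => sparseSup_le hD fun _ hT =>
      norm_apply_le_sparseSup hb hD (sparseDilations_antitone x hk hT) f)
    ⟨0, by rintro _ ⟨k, rfl⟩; exact sparseSup_nonneg k f⟩

theorem spreadNorm_add_le (hb : IsBasis x xs) (hD : SubsymWith 𝕜 (fun f : X => ‖f‖) x D)
    (f g : X) : spreadNorm 𝕜 x (f + g) ≤ spreadNorm 𝕜 x f + spreadNorm 𝕜 x g := by
  refine ge_of_tendsto' ((tendsto_sparseSup hb hD f).add (tendsto_sparseSup hb hD g))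
    fun k => (spreadNorm_le_sparseSup k _).trans (sparseSup_le hD fun T hT => ?_)
  rw [map_add]
  have hf := norm_apply_le_sparseSup hb hD hT f
  have hg := norm_apply_le_sparseSup hb hD hT g
  exact (norm_add_le _ _).trans (by linarith)

theorem spreadNorm_smul (a : 𝕜) (f : X) :
    spreadNorm 𝕜 x (a • f) = ‖a‖ * spreadNorm 𝕜 x f := by
  have h : ∀ k, sparseSup 𝕜 x k (a • f) = ‖a‖ * sparseSup 𝕜 x k f := fun k => by
    rw [sparseSup, sparseSup, ← smul_eq_mul, ← Real.sSup_smul_of_nonneg (norm_nonneg a)]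
    congr 1
    ext r
    simp [Set.mem_smul_set, norm_smul]
  simp only [spreadNorm, h, Real.mul_iInf_of_nonneg (norm_nonneg a)]

theorem spreadNorm_le (hb : IsBasis x xs) (hD : SubsymWith 𝕜 (fun f : X => ‖f‖) x D)
    (f : X) : spreadNorm 𝕜 x f ≤ D * ‖f‖ :=
  (spreadNorm_le_sparseSup 0 f).trans (sparseSup_le hD fun T hT => by
    obtain ⟨lam, β, hT, -⟩ := hT
    exact (hT.bounds hb hD f).1)

theorem le_mul_spreadNorm (hb : IsBasis x xs) (hD : SubsymWith 𝕜 (fun f : X => ‖f‖) x D)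
    {c : ℝ} (hc : 0 ≤ c) {f : X} {r : ℝ}
    (h : ∀ lam β T, IsDilatedSign (𝕜 := 𝕜) x lam β T → r ≤ c * ‖T f‖) :
    r ≤ c * spreadNorm 𝕜 x f := by
  refine ge_of_tendsto' ((tendsto_sparseSup hb hD f).const_mul c) fun k => ?_
  obtain ⟨T, hT⟩ := sparseDilations_nonempty hD k
  obtain ⟨lam, β, hTd, -⟩ := id hT
  exact (h _ _ _ hTd).trans
    (mul_le_mul_of_nonneg_left (norm_apply_le_sparseSup hb hD hT f) hc)

theorem isEquivNorm_spreadNorm (hb : IsBasis x xs) (hD1 : 1 ≤ D)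
    (hD : SubsymWith 𝕜 (fun f : X => ‖f‖) x D) : IsEquivNorm 𝕜 (spreadNorm 𝕜 x) where
  add_le := spreadNorm_add_le hb hD
  smul_eq := spreadNorm_smul
  lower := by
    have hD0 : 0 < D := by linarith
    refine ⟨D⁻¹, inv_pos.2 hD0, fun f => ?_⟩
    rw [inv_mul_le_iff₀ hD0]
    exact le_mul_spreadNorm hb hD hD0.le fun _ _ T hT => (hT.bounds hb hD f).2
  upper := ⟨D, by linarith, spreadNorm_le hb hD⟩

theorem IsEquivNorm.continuous {ν : X → ℝ} (hν : IsEquivNorm 𝕜 ν) : Continuous ν := by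
  obtain ⟨K, hK, hle⟩ := hν.upper
  refine (LipschitzWith.of_le_add_mul ⟨K, hK.le⟩ fun f g => ?_).continuous
  calc ν f = ν (g + (f - g)) := by rw [add_sub_cancel]
    _ ≤ ν g + ν (f - g) := hν.add_le _ _
    _ ≤ ν g + K * dist f g := by rw [dist_eq_norm]; gcongr; exact hle _

theorem spreadNorm_map_le (hb : IsBasis x xs) (hD : SubsymWith 𝕜 (fun f : X => ‖f‖) x D)
    {lam : ℕ → 𝕜} {γ : ℕ → ℕ} {T : X →L[𝕜] X} (hT : IsDilatedSign x lam γ T) (f : X) :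
    spreadNorm 𝕜 x (T f) ≤ spreadNorm 𝕜 x f := by
  refine ge_of_tendsto' (tendsto_sparseSup hb hD f) fun k =>
    (spreadNorm_le_sparseSup k _).trans (sparseSup_le hD fun U hU => ?_)
  obtain ⟨mu, β, hU, hβ⟩ := hU
  exact norm_apply_le_sparseSup hb hD (T := U.comp T)
    ⟨_, _, hU.comp hT, fun n => hβ (γ n)⟩ f

theorem spreadNorm_le_map_of_mem_span (hb : IsBasis x xs)
    (hD : SubsymWith 𝕜 (fun f : X => ‖f‖) x D) {lam : ℕ → 𝕜} {γ : ℕ → ℕ} {T : X →L[𝕜] X}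
    (hT : IsDilatedSign x lam γ T) {f : X} (hf : f ∈ Submodule.span 𝕜 (Set.range x)) :
    spreadNorm 𝕜 x f ≤ spreadNorm 𝕜 x (T f) := by
  obtain ⟨N, hN⟩ := exists_initial_determining (𝕜 := 𝕜) x hf
  refine ge_of_tendsto' (tendsto_sparseSup hb hD (T f)) fun k => ?_
  obtain ⟨k', hk'⟩ := exists_sparse_factorization hT.strictMono N k
  refine (spreadNorm_le_sparseSup k' f).trans (sparseSup_le hD fun U hU => ?_)
  obtain ⟨mu, β, hU, hβ⟩ := hU
  obtain ⟨β', hβ'_mono, hβ', hβ'γ⟩ := hk' β hU.strictMono hβ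
  let mu' : ℕ → 𝕜 := fun m =>
    mu (Function.invFun γ m) * (lam (Function.invFun γ m))⁻¹
  have hmu' : ∀ n, ‖mu' n‖ = 1 := fun n => by
    simp only [mu', norm_mul, norm_inv, hU.norm_eq, hT.norm_eq, inv_one, one_mul]
  obtain ⟨V, hV, -⟩ := hD mu' hmu' β' hβ'_mono
  have hUV : U f = V.comp T f := hN _ _ fun n hn => by
    have hne : lam n ≠ 0 := norm_ne_zero_iff.1 (by rw [hT.norm_eq]; exact one_ne_zero)
    have hmul : lam n * mu' (γ n) = mu n := by
      simp only [mu', Function.leftInverse_invFun hT.strictMono.injective n]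
      field_simp
    rw [ContinuousLinearMap.comp_apply, hT.map_basis, map_smul, hV, hU.map_basis, smul_smul,
      hβ'γ n hn, hmul]
  rw [hUV]
  exact norm_apply_le_sparseSup hb hD ⟨mu', β', ⟨hmu', hβ'_mono, hV⟩, hβ'⟩ (T f)

theorem spreadNorm_map (hb : IsBasis x xs) (hD1 : 1 ≤ D)
    (hD : SubsymWith 𝕜 (fun f : X => ‖f‖) x D) {lam : ℕ → 𝕜} {γ : ℕ → ℕ} {T : X →L[𝕜] X}
    (hT : IsDilatedSign x lam γ T) (f : X) :
    spreadNorm 𝕜 x (T f) = spreadNorm 𝕜 x f := by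
  have hcont := (isEquivNorm_spreadNorm hb hD1 hD).continuous
  have hclosed : IsClosed {f : X | spreadNorm 𝕜 x f ≤ spreadNorm 𝕜 x (T f)} :=
    isClosed_le hcont (hcont.comp T.continuous)
  exact (spreadNorm_map_le hb hD hT f).antisymm
    (closure_minimal (fun g hg => spreadNorm_le_map_of_mem_span hb hD hT hg) hclosed
      (hb.dense f))

theorem greedyWith_spreadNorm (hb : IsBasis x xs)
    (hD : SubsymWith 𝕜 (fun f : X => ‖f‖) x D) {C : ℝ} (hC : 0 ≤ C)
    (hg : GreedyWith (fun f : X => ‖f‖) x xs C) : GreedyWith (spreadNorm 𝕜 x) x xs C := by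
  intro f A B a hA hBA
  refine ge_of_tendsto' ((tendsto_sparseSup hb hD _).const_mul C) fun k =>
    (spreadNorm_le_sparseSup k _).trans (sparseSup_le hD fun T hT => ?_)
  obtain ⟨lam, β, hTd, -⟩ := id hT
  exact (hTd.greedy_le hb hg a hA hBA).trans
    (mul_le_mul_of_nonneg_left (norm_apply_le_sparseSup hb hD hT _) hC)

theorem fundFunWith_spreadNorm_le (hb : IsBasis x xs)
    (hD : SubsymWith 𝕜 (fun f : X => ‖f‖) x D) (m : ℕ) :
    fundFunWith 𝕜 (spreadNorm 𝕜 x) x m ≤ fundFun 𝕜 x m := by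
  obtain ⟨K, hK⟩ := hb.norm_bdd
  refine csSup_le ⟨_, ∅, fun _ => 1, by simp, by simp, rfl⟩ ?_
  rintro _ ⟨A, ε, hA, hε, rfl⟩
  refine (spreadNorm_le_sparseSup 0 _).trans (sparseSup_le hD fun T hT => ?_)
  obtain ⟨lam, β, hT, -⟩ := hT
  exact hT.norm_map_signed_sum_le hK hA hε

theorem dualFundFunWith_spreadNorm_le (hb : IsBasis x xs)
    (hD : SubsymWith 𝕜 (fun f : X => ‖f‖) x D) (m : ℕ) :
    dualFundFunWith (spreadNorm 𝕜 x) xs m ≤ fundFun 𝕜 xs m := by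
  have hpos : 0 ≤ fundFun 𝕜 xs m := Real.sSup_nonneg (by
    rintro _ ⟨A, ε, -, -, rfl⟩; exact norm_nonneg _)
  refine csSup_le ⟨_, ∅, fun _ => 1, by simp, by simp, rfl⟩ ?_
  rintro _ ⟨B, δ, hB, hδ, rfl⟩
  refine Real.sSup_le ?_ hpos
  rintro _ ⟨f, hf, rfl⟩
  calc ‖(∑ n ∈ B, δ n • xs n) f‖ ≤ fundFun 𝕜 xs m * spreadNorm 𝕜 x f :=
        le_mul_spreadNorm hb hD hpos fun _ _ _ hT => hT.norm_dual_signed_sum_le hb hB hδ f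
    _ ≤ fundFun 𝕜 xs m * 1 := mul_le_mul_of_nonneg_left hf hpos
    _ = fundFun 𝕜 xs m := mul_one _

end DilatedSigns

/-- Lemma 5.1: a subsymmetric `C`-greedy basis admits a renorming which
is isometrically subsymmetric and `C`-greedy, without increasing the fundamental functions
of the basis and of its dual system. -/
theorem subsymmetric_greedy_renorming {𝕜 : Type*} [RCLike 𝕜] {X : Type*}
    [NormedAddCommGroup X] [NormedSpace 𝕜 X] [CompleteSpace X]
    (x : ℕ → X) (xs : ℕ → X →L[𝕜] 𝕜) (hb : IsBasis x xs)
    (C : ℝ) (hC : 1 ≤ C) (hg : GreedyWith (fun f : X => ‖f‖) x xs C)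
    (hss : ∃ C' : ℝ, 1 ≤ C' ∧ SubsymWith 𝕜 (fun f : X => ‖f‖) x C') :
    ∃ ν : X → ℝ, IsEquivNorm 𝕜 ν ∧ SubsymWith 𝕜 ν x 1 ∧ GreedyWith ν x xs C ∧
      (∀ m : ℕ, 1 ≤ m → fundFunWith 𝕜 ν x m ≤ fundFun 𝕜 x m) ∧
      (∀ m : ℕ, 1 ≤ m → dualFundFunWith ν xs m ≤ fundFun 𝕜 xs m) := by
  obtain ⟨D, hD1, hD⟩ := hss
  refine ⟨spreadNorm 𝕜 x, isEquivNorm_spreadNorm hb hD1 hD, fun lam hlam β hβ => ?_,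
    greedyWith_spreadNorm hb hD (by linarith) hg,
    fun m _ => fundFunWith_spreadNorm_le hb hD m,
    fun m _ => dualFundFunWith_spreadNorm_le hb hD m⟩
  obtain ⟨T, hT, -⟩ := hD lam hlam β hβ
  have h := spreadNorm_map hb hD1 hD (T := T) ⟨hlam, hβ, hT⟩
  exact ⟨T, hT, fun f => by rw [h, one_mul], fun f => by rw [h, one_mul]⟩

end GreedyRenorm
end
end
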